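/- arXiv:1403.7399 — 7 statements merged into one kernel-verified Lean document; each statement's English description precedes it below -/
import Mathlib

section
/- For all integers m, n, a, b, the quotient of the free abelian group ℤ³ by the subgroup generated by the three elements (−m, m+1, 0), (−n, n+1, 0) and (a, b, 1) is isomorphic, as an additive group, to ℤ/(n−m)ℤ. -/
def maroniHom (m a b : ℤ) : (ℤ × ℤ × ℤ) →+ ℤ where
  toFun v := (m + 1) * (v.1 - v.2.2 * a) + m * (v.2.1 - v.2.2 * b)
  map_zero' := by simp
  map_add' := by
    intro u v
    simp only [Prod.fst_add, Prod.snd_add]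
    ring

theorem maroniHom_apply (m a b x y z : ℤ) :
    maroniHom m a b (x, y, z) = (m + 1) * (x - z * a) + m * (y - z * b) := rfl

/-- For all integers `m, n, a, b`, the quotient of the free abelian group `ℤ³` by the
subgroup generated by the three elements `(-m, m+1, 0)`, `(-n, n+1, 0)` and `(a, b, 1)`
is isomorphic, as an additive group, to `ℤ/(n-m)ℤ`. -/
theorem cokernel_maroni_lattice (m n a b : ℤ) :
    Nonempty
      (((ℤ × ℤ × ℤ) ⧸
          AddSubgroup.closure {(-m, m + 1, 0), (-n, n + 1, 0), (a, b, 1)}) ≃+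
        (ℤ ⧸ AddSubgroup.zmultiples (n - m))) := by
  let f : (ℤ × ℤ × ℤ) →+ (ℤ ⧸ AddSubgroup.zmultiples (n - m)) :=
    (QuotientAddGroup.mk' (AddSubgroup.zmultiples (n - m))).comp (maroniHom m a b)
  have hmem : ∀ v, v ∈ f.ker ↔ ∃ k : ℤ, k * (n - m) = maroniHom m a b v := by
    intro v
    rw [AddMonoidHom.mem_ker]
    change ((maroniHom m a b v : ℤ) : ℤ ⧸ AddSubgroup.zmultiples (n - m)) = 0 ↔ _
    rw [QuotientAddGroup.eq_zero_iff, AddSubgroup.mem_zmultiples_iff]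
    simp only [smul_eq_mul]
  have hf : Function.Surjective f := by
    intro q
    obtain ⟨t, rfl⟩ := QuotientAddGroup.mk'_surjective _ q
    refine ⟨(t, -t, 0), ?_⟩
    change QuotientAddGroup.mk' _ (maroniHom m a b (t, -t, 0)) = _
    rw [maroniHom_apply]
    congr 1
    ring
  have hk : AddSubgroup.closure {(-m, m + 1, 0), (-n, n + 1, 0), (a, b, 1)} = f.ker := by
    apply le_antisymm
    · rw [AddSubgroup.closure_le]
      rintro v (rfl | rfl | rfl)
      · exact (hmem _).2 ⟨0, by rw [maroniHom_apply]; ring⟩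
      · exact (hmem _).2 ⟨-1, by rw [maroniHom_apply]; ring⟩
      · exact (hmem _).2 ⟨0, by rw [maroniHom_apply]; ring⟩
    · rintro ⟨x, y, z⟩ hv
      obtain ⟨k, hk⟩ := (hmem _).1 hv
      rw [maroniHom_apply] at hk
      have key : ((x, y, z) : ℤ × ℤ × ℤ) =
          ((x - z * a) + (y - z * b) + k) • ((-m, m + 1, 0) : ℤ × ℤ × ℤ)
          + (-k) • ((-n, n + 1, 0) : ℤ × ℤ × ℤ) + z • ((a, b, 1) : ℤ × ℤ × ℤ) := by
        simp only [Prod.smul_mk, Prod.mk_add_mk, smul_eq_mul, Prod.mk.injEq]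
        refine ⟨?_, ?_, ?_⟩
        · linear_combination -hk
        · linear_combination hk
        · ring
      rw [key]
      refine add_mem (add_mem ?_ ?_) ?_ <;>
        exact zsmul_mem (AddSubgroup.subset_closure (by simp)) _
  exact ⟨(QuotientAddGroup.quotientAddEquivOfEq hk).trans
    (QuotientAddGroup.quotientKerEquivOfSurjective f hf)⟩
end

section
/- Let M ≥ 1 be an integer and g = 3M − 2. Let V = (ℤ/2ℤ)^{2g+2} with standard basis e₁, …, e_{2g+2} (1-based indices) and let B be the symmetric bilinear form on V determined by B(eᵢ, eⱼ) = 1 if 1 ≤ |i − j| ≤ 2 and B(eᵢ, eⱼ) = 0 otherwise. Then the vectors r₁ = Σ_{k=0}^{2M−1} e_{3k+1} and r₂ = Σ_{k=0}^{M−1} (e_{6k+1} + e_{6k+2} + e_{6k+3}) lie in the radical of B, i.e. B(r₁, v) = 0 and B(r₂, v) = 0 for all v ∈ V. -/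
open Finset

/-- The mod-2 intersection form of the Milnor fibre of `y³ + x^(g+2)` on
`V = (ℤ/2ℤ)^(2g+2)`, determined on the standard basis by `B(eᵢ,eⱼ) = 1` iff
`1 ≤ |i - j| ≤ 2`. -/
def milnorForm (g : ℕ) (v w : Fin (2 * g + 2) → ZMod 2) : ZMod 2 :=
  ∑ i, ∑ j,
    if 1 ≤ Nat.dist i.val j.val ∧ Nat.dist i.val j.val ≤ 2 then v i * w j else 0

/-- `r₁ = Σ_{k=0}^{2M-1} e_{3k+1}` (with `e₁, …, e_{2g+2}` the 1-based standard basis,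
so `e_{3k+1}` is the indicator of the 0-based coordinate `3k`). -/
def radGen₁ (M g : ℕ) : Fin (2 * g + 2) → ZMod 2 :=
  ∑ k ∈ Finset.range (2 * M), fun i => if (i : ℕ) = 3 * k then 1 else 0

/-- `r₂ = Σ_{k=0}^{M-1} (e_{6k+1} + e_{6k+2} + e_{6k+3})`. -/
def radGen₂ (M g : ℕ) : Fin (2 * g + 2) → ZMod 2 :=
  ∑ k ∈ Finset.range M, fun i =>
    if (i : ℕ) = 6 * k ∨ (i : ℕ) = 6 * k + 1 ∨ (i : ℕ) = 6 * k + 2 then 1 else 0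

theorem aux_sum (N j : ℕ) (hj : j < N) (f : ℕ → ZMod 2) :
    (∑ i ∈ Finset.range N, if 1 ≤ Nat.dist i j ∧ Nat.dist i j ≤ 2 then f i else 0) =
    (if 2 ≤ j then f (j - 2) else 0) + (if 1 ≤ j then f (j - 1) else 0) +
    (if j + 1 < N then f (j + 1) else 0) + (if j + 2 < N then f (j + 2) else 0) := by
  have h : ∀ i ∈ Finset.range N,
      (if 1 ≤ Nat.dist i j ∧ Nat.dist i j ≤ 2 then f i else 0) =
      (if i = j - 2 then (if 2 ≤ j then f i else 0) else 0) +
      (if i = j - 1 then (if 1 ≤ j then f i else 0) else 0) +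
      (if i = j + 1 then f i else 0) + (if i = j + 2 then f i else 0) := by
    intro i _
    unfold Nat.dist
    split_ifs <;> first | omega | simp
  rw [Finset.sum_congr rfl h]
  simp only [Finset.sum_add_distrib, Finset.sum_ite_eq', Finset.mem_range]
  rw [if_pos (by omega : j - 2 < N), if_pos (by omega : j - 1 < N)]

theorem aux_form (g : ℕ) (r v : Fin (2 * g + 2) → ZMod 2) (f : ℕ → ZMod 2)
    (hr : ∀ i, r i = f i.val)
    (hf : ∀ j < 2 * g + 2,
      (if 2 ≤ j then f (j - 2) else 0) + (if 1 ≤ j then f (j - 1) else 0) +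
      (if j + 1 < 2 * g + 2 then f (j + 1) else 0) +
      (if j + 2 < 2 * g + 2 then f (j + 2) else 0) = 0) :
    milnorForm g r v = 0 := by
  unfold milnorForm
  rw [Finset.sum_comm]
  refine Finset.sum_eq_zero fun j _ => ?_
  have e := aux_sum (2 * g + 2) j j.2 f
  rw [hf j j.2, ← Fin.sum_univ_eq_sum_range
    (fun i => if 1 ≤ Nat.dist i j ∧ Nat.dist i j ≤ 2 then f i else 0)] at e
  refine Eq.trans ?_ ((congrArg (· * v j) e).trans (zero_mul (v j)))
  beta_reduce
  rw [Finset.sum_mul]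
  refine Finset.sum_congr rfl fun i _ => ?_
  rw [hr, ite_mul, zero_mul]

theorem aux_r1 (M g : ℕ) (hM : 1 ≤ M) (hg : g = 3 * M - 2) (i : Fin (2 * g + 2)) :
    radGen₁ M g i = if i.val % 3 = 0 then 1 else 0 := by
  have hi := i.2
  unfold radGen₁
  rw [Finset.sum_apply]
  split_ifs with h
  · rw [Finset.sum_eq_single (i.val / 3)]
    · rw [if_pos (by omega)]
    · intro b _ hb
      rw [if_neg (by omega)]
    · intro hb
      rw [Finset.mem_range] at hb
      omega
  · refine Finset.sum_eq_zero fun k _ => ?_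
    rw [if_neg (by omega)]

theorem aux_r2 (M g : ℕ) (hM : 1 ≤ M) (hg : g = 3 * M - 2) (i : Fin (2 * g + 2)) :
    radGen₂ M g i = if i.val % 6 < 3 then 1 else 0 := by
  have hi := i.2
  unfold radGen₂
  rw [Finset.sum_apply]
  split_ifs with h
  · rw [Finset.sum_eq_single (i.val / 6)]
    · rw [if_pos (by omega)]
    · intro b _ hb
      rw [if_neg (by omega)]
    · intro hb
      rw [Finset.mem_range] at hb
      omega
  · refine Finset.sum_eq_zero fun k _ => ?_
    rw [if_neg (by omega)]

/-- Let `M ≥ 1` and `g = 3M - 2`.  On `V = (ℤ/2ℤ)^(2g+2)` with the form `B` given by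
`B(eᵢ,eⱼ) = 1` iff `1 ≤ |i-j| ≤ 2`, the vectors `r₁ = Σ_{k<2M} e_{3k+1}` and
`r₂ = Σ_{k<M} (e_{6k+1} + e_{6k+2} + e_{6k+3})` lie in the radical of `B`. -/
theorem radical_generators_in_radical (M : ℕ) (hM : 1 ≤ M) (g : ℕ) (hg : g = 3 * M - 2) :
    ∀ v : Fin (2 * g + 2) → ZMod 2,
      milnorForm g (radGen₁ M g) v = 0 ∧ milnorForm g (radGen₂ M g) v = 0 := by
  intro v
  constructor
  · refine aux_form g _ v (fun n => if n % 3 = 0 then 1 else 0) (aux_r1 M g hM hg) ?_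
    intro j hj
    split_ifs <;> first | omega | decide
  · refine aux_form g _ v (fun n => if n % 6 < 3 then 1 else 0) (aux_r2 M g hM hg) ?_
    intro j hj
    split_ifs <;> first | omega | decide
end

section
/- Let M ≥ 1 be an integer and g = 3M − 2. Let V = (ℤ/2ℤ)^{2g+2} with standard basis e₁, …, e_{2g+2} (1-based indices) and let B be the symmetric bilinear form on V determined by B(eᵢ, eⱼ) = 1 if 1 ≤ |i − j| ≤ 2 and B(eᵢ, eⱼ) = 0 otherwise. Then the radical of B, i.e. {v ∈ V : B(v, w) = 0 for all w ∈ V}, is exactly the 2-dimensional subspace spanned by r₁ = Σ_{k=0}^{2M−1} e_{3k+1} and r₂ = Σ_{k=0}^{M−1} (e_{6k+1} + e_{6k+2} + e_{6k+3}); in particular B has rank 2g. -/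
open Finset

def uu {N : ℕ} (v : Fin N → ZMod 2) (m : ℕ) : ZMod 2 :=
  ∑ i : Fin N, if (i : ℕ) + 2 = m then v i else 0

lemma uu_in {N : ℕ} (v : Fin N → ZMod 2) (i : Fin N) : uu v (i + 2) = v i := by
  unfold uu
  rw [Finset.sum_eq_single i]
  · simp
  · intro b _ hb
    rw [if_neg]
    intro h
    exact hb (Fin.ext (by omega))
  · simp

lemma uu_out {N : ℕ} (v : Fin N → ZMod 2) (m : ℕ) (h : m < 2 ∨ N + 2 ≤ m) : uu v m = 0 := by
  unfold uu
  apply Finset.sum_eq_zero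
  intro i _
  rw [if_neg]
  have := i.2
  omega

lemma row_eq (g : ℕ) (v : Fin (2 * g + 2) → ZMod 2) (w : Fin (2 * g + 2) → ZMod 2) :
    milnorForm g v w = ∑ j : Fin (2 * g + 2),
      (uu v j + uu v (j + 1) + uu v (j + 3) + uu v (j + 4)) * w j := by
  unfold milnorForm
  rw [Finset.sum_comm]
  apply Finset.sum_congr rfl
  intro j _
  unfold uu
  rw [← Finset.sum_add_distrib, ← Finset.sum_add_distrib, ← Finset.sum_add_distrib,
    Finset.sum_mul]
  apply Finset.sum_congr rfl
  intro i _
  unfold Nat.dist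
  split_ifs <;> first | omega | simp

lemma rad_iff (g : ℕ) (v : Fin (2 * g + 2) → ZMod 2) :
    (∀ w, milnorForm g v w = 0) ↔
      ∀ j < 2 * g + 2, uu v j + uu v (j + 1) + uu v (j + 3) + uu v (j + 4) = 0 := by
  constructor
  · intro h j hj
    have := h (Pi.single ⟨j, hj⟩ 1)
    rw [row_eq, Finset.sum_eq_single ⟨j, hj⟩] at this
    · simpa using this
    · intro b _ hb
      simp [Pi.single_eq_of_ne hb]
    · simp
  · intro h w
    rw [row_eq]
    apply Finset.sum_eq_zero
    intro j _
    rw [h j j.2, zero_mul]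

def PP (a b : ZMod 2) (m : ℕ) : ZMod 2 :=
  a * (if m % 3 = 2 then 1 else 0) + b * (if 2 ≤ m % 6 ∧ m % 6 ≤ 4 then 1 else 0)

lemma PP_rec (a b : ZMod 2) (m : ℕ) :
    PP a b m + PP a b (m + 1) + PP a b (m + 3) + PP a b (m + 4) = 0 := by
  have h : m % 6 < 6 := Nat.mod_lt _ (by norm_num)
  have e : ∀ k, (m + k) % 3 = (m % 6 + k) % 3 := by intro k; omega
  have e' : ∀ k, (m + k) % 6 = (m % 6 + k) % 6 := by intro k; omega
  have e0 : m % 3 = (m % 6) % 3 := by omega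
  unfold PP
  rw [e, e, e, e', e', e', e0]
  generalize m % 6 = r at h
  clear e e' e0
  interval_cases r <;> revert a b <;> decide

lemma r1_apply (M : ℕ) (g : ℕ) (hM : 1 ≤ M) (hg : g = 3 * M - 2) (i : Fin (2 * g + 2)) :
    radGen₁ M g i = if ((i : ℕ) + 2) % 3 = 2 then 1 else 0 := by
  have := i.2
  unfold radGen₁
  rw [Finset.sum_apply]
  split_ifs with h
  · rw [Finset.sum_eq_single ((i : ℕ) / 3)]
    · rw [if_pos]; omega
    · intro b _ hb
      rw [if_neg]; omega
    · intro hb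
      exfalso; apply hb; rw [Finset.mem_range]; omega
  · apply Finset.sum_eq_zero
    intro k _
    rw [if_neg]; omega

lemma r2_apply (M : ℕ) (g : ℕ) (hM : 1 ≤ M) (hg : g = 3 * M - 2) (i : Fin (2 * g + 2)) :
    radGen₂ M g i = if 2 ≤ ((i : ℕ) + 2) % 6 ∧ ((i : ℕ) + 2) % 6 ≤ 4 then 1 else 0 := by
  have := i.2
  unfold radGen₂
  rw [Finset.sum_apply]
  split_ifs with h
  · rw [Finset.sum_eq_single ((i : ℕ) / 6)]
    · rw [if_pos]; omega
    · intro b _ hb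
      rw [if_neg]; omega
    · intro hb
      exfalso; apply hb; rw [Finset.mem_range]; omega
  · apply Finset.sum_eq_zero
    intro k _
    rw [if_neg]; omega

lemma uu_eq_PP (g : ℕ) (v : Fin (2 * g + 2) → ZMod 2)
    (h : ∀ j < 2 * g + 2, uu v j + uu v (j + 1) + uu v (j + 3) + uu v (j + 4) = 0) (m : ℕ) :
    m < 2 * g + 6 → uu v m = PP (uu v 2 + uu v 3) (uu v 3) m := by
  have key : ∀ p q r s p' q' r' s' : ZMod 2, p + q + r + s = 0 → p' + q' + r' + s' = 0 →
    p = p' → q = q' → r = r' → s = s' := by decide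
  have k2 : ∀ a b : ZMod 2, a = a + b + b := by decide
  induction m using Nat.strong_induction_on with
  | _ m ih =>
    intro hm
    match m, ih, hm with
    | 0, _, _ => rw [uu_out v 0 (by omega)]; simp [PP]
    | 1, _, _ => rw [uu_out v 1 (by omega)]; simp [PP]
    | 2, _, _ => simpa [PP] using k2 _ _
    | 3, _, _ => simp [PP]
    | j + 4, ih, hm =>
      exact key _ _ _ _ _ _ _ _ (h j (by omega)) (PP_rec _ _ j) (ih j (by omega) (by omega))
        (ih (j + 1) (by omega) (by omega)) (ih (j + 3) (by omega) (by omega))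

/-- Let `M ≥ 1` and `g = 3M - 2`.  The radical `{v | ∀ w, B(v,w) = 0}` of the form `B`
(with `B(eᵢ,eⱼ) = 1` iff `1 ≤ |i-j| ≤ 2`) on `V = (ℤ/2ℤ)^(2g+2)` is exactly the
2-dimensional subspace spanned by `r₁` and `r₂`; in particular `B` has rank `2g`,
i.e. `V` modulo the radical has dimension `2g`. -/
theorem radical_is_span (M : ℕ) (hM : 1 ≤ M) (g : ℕ) (hg : g = 3 * M - 2) :
    {v : Fin (2 * g + 2) → ZMod 2 | ∀ w, milnorForm g v w = 0} =
      ↑(Submodule.span (ZMod 2) {radGen₁ M g, radGen₂ M g}) ∧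
    Module.finrank (ZMod 2)
      ↥(Submodule.span (ZMod 2) {radGen₁ M g, radGen₂ M g}) = 2 ∧
    Module.finrank (ZMod 2)
      ((Fin (2 * g + 2) → ZMod 2) ⧸
        Submodule.span (ZMod 2) {radGen₁ M g, radGen₂ M g}) = 2 * g := by
  have hcomb : ∀ (a b : ZMod 2) (i : Fin (2 * g + 2)),
      (a • radGen₁ M g + b • radGen₂ M g) i = PP a b (i + 2) := by
    intro a b i
    rw [Pi.add_apply, Pi.smul_apply, Pi.smul_apply, r1_apply M g hM hg, r2_apply M g hM hg]
    rfl
  have hfin : Module.finrank (ZMod 2)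
      ↥(Submodule.span (ZMod 2) {radGen₁ M g, radGen₂ M g}) = 2 := by
    have hli : LinearIndependent (ZMod 2) ![radGen₁ M g, radGen₂ M g] := by
      rw [LinearIndependent.pair_iff]
      intro s t hst
      have h0 := hcomb s t ⟨0, by omega⟩
      have h1 := hcomb s t ⟨1, by omega⟩
      rw [hst] at h0 h1
      simp [PP] at h0 h1
      subst h1
      simpa using h0.symm
    have := finrank_span_eq_card hli
    rw [Matrix.range_cons_cons_empty] at this
    simpa using this
  refine ⟨?_, hfin, ?_⟩
  · ext v
    rw [Set.mem_ofPred_eq, rad_iff, SetLike.mem_coe, Submodule.mem_span_pair]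
    constructor
    · intro h
      refine ⟨uu v 2 + uu v 3, uu v 3, ?_⟩
      ext1 i
      rw [hcomb, ← uu_in v i]
      exact (uu_eq_PP g v h _ (by omega)).symm
    · rintro ⟨a, b, rfl⟩ j hj
      have hu : ∀ m < 2 * g + 6, uu (a • radGen₁ M g + b • radGen₂ M g) m = PP a b m := by
        intro m hm
        by_cases h : m < 2 ∨ 2 * g + 2 + 2 ≤ m
        · rw [uu_out _ _ h]
          unfold PP
          rw [if_neg (by omega), if_neg (by omega)]
          simp
        · have := uu_in (a • radGen₁ M g + b • radGen₂ M g) ⟨m - 2, by omega⟩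
          rw [hcomb] at this
          have e : m - 2 + 2 = m := by omega
          simpa only [e] using this
      rw [hu _ (by omega), hu _ (by omega), hu _ (by omega), hu _ (by omega), PP_rec]
  · have := Submodule.finrank_quotient_add_finrank
      (Submodule.span (ZMod 2) {radGen₁ M g, radGen₂ M g})
    rw [hfin, Module.finrank_fin_fun] at this
    omega
end

section
/- Let M ≥ 1 be an integer and g = 3M − 2. Let V = (ℤ/2ℤ)^{2g+2} with standard basis e₁, …, e_{2g+2}, B the symmetric bilinear form with B(eᵢ,eⱼ) = 1 iff 1 ≤ |i−j| ≤ 2, and q : V → ℤ/2ℤ the quadratic form q(v) = Σ_{i=1}^{2g+2} vᵢ + Σ_{1 ≤ i < j ≤ 2g+2, j−i ≤ 2} vᵢvⱼ. Then q vanishes on the span of r₁ = Σ_{k=0}^{2M−1} e_{3k+1} and r₂ = Σ_{k=0}^{M−1} (e_{6k+1} + e_{6k+2} + e_{6k+3}): for every v in that span, q(v) = 0. -/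
open Finset

/-- The quadratic refinement `q(v) = Σᵢ vᵢ + Σ_{i<j, j-i≤2} vᵢ vⱼ` of `milnorForm`,
the unique quadratic form with `q(eᵢ) = 1` refining `B`. -/
def milnorQuad (g : ℕ) (v : Fin (2 * g + 2) → ZMod 2) : ZMod 2 :=
  (∑ i, v i) +
    ∑ i : Fin (2 * g + 2), ∑ j : Fin (2 * g + 2),
      if i < j ∧ j.val - i.val ≤ 2 then v i * v j else 0

def auxF (a b : ZMod 2) (i : ℕ) : ZMod 2 :=
  a * (if i % 3 = 0 then 1 else 0) + b * (if i % 6 < 3 then 1 else 0)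

theorem rad1_eq (M g : ℕ) (hg : 2 * g + 4 = 6 * M) (i : Fin (2 * g + 2)) :
    radGen₁ M g i = if (i : ℕ) % 3 = 0 then 1 else 0 := by
  have hi := i.2
  unfold radGen₁
  rw [Finset.sum_apply]
  split_ifs with h
  · rw [Finset.sum_eq_single ((i : ℕ) / 3)]
    · rw [if_pos (by omega)]
    · intro k _ hk
      rw [if_neg (by omega)]
    · intro hk
      exact absurd (Finset.mem_range.2 (by omega)) hk
  · apply Finset.sum_eq_zero
    intro k _
    rw [if_neg (by omega)]

theorem rad2_eq (M g : ℕ) (hg : 2 * g + 4 = 6 * M) (i : Fin (2 * g + 2)) :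
    radGen₂ M g i = if (i : ℕ) % 6 < 3 then 1 else 0 := by
  have hi := i.2
  unfold radGen₂
  rw [Finset.sum_apply]
  split_ifs with h
  · rw [Finset.sum_eq_single ((i : ℕ) / 6)]
    · rw [if_pos (by omega)]
    · intro k _ hk
      rw [if_neg (by omega)]
    · intro hk
      exact absurd (Finset.mem_range.2 (by omega)) hk
  · apply Finset.sum_eq_zero
    intro k _
    rw [if_neg (by omega)]

theorem quad_eq (g : ℕ) (f : ℕ → ZMod 2) (h0 : f (2 * g + 2) = 0) (h1 : f (2 * g + 3) = 0) :
    milnorQuad g (fun i => f i) =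
      ∑ i ∈ Finset.range (2 * g + 4), f i * (1 + f (i + 1) + f (i + 2)) := by
  have inner : ∀ i : Fin (2 * g + 2), (∑ j : Fin (2 * g + 2),
      if i < j ∧ j.val - i.val ≤ 2 then f i * f j else 0)
        = f i * f (i + 1) + f i * f (i + 2) := by
    intro i
    have hi := i.2
    have e1 := Fin.sum_univ_eq_sum_range
      (fun j => if i.val < j ∧ j - i.val ≤ 2 then f i * f j else 0) (2 * g + 2)
    simp only [Fin.lt_def]
    rw [e1]
    have e2 : ∀ j ∈ Finset.range (2 * g + 2),
        (if i.val < j ∧ j - i.val ≤ 2 then f i * f j else 0)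
        = (if j = i.val + 1 then f i * f j else 0) + (if j = i.val + 2 then f i * f j else 0) := by
      intro j _
      by_cases c1 : j = i.val + 1
      · rw [if_pos (by omega), if_pos c1, if_neg (by omega), add_zero]
      · by_cases c2 : j = i.val + 2
        · rw [if_pos (by omega), if_neg c1, if_pos c2, zero_add]
        · rw [if_neg (by omega), if_neg c1, if_neg c2, zero_add]
    rw [Finset.sum_congr rfl e2, Finset.sum_add_distrib, Finset.sum_ite_eq', Finset.sum_ite_eq']
    simp only [Finset.mem_range]
    congr 1
    · split_ifs with c
      · rfl
      · rw [show i.val + 1 = 2 * g + 2 by omega, h0, mul_zero]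
    · split_ifs with c
      · rfl
      · rcases (show i.val + 2 = 2 * g + 2 ∨ i.val + 2 = 2 * g + 3 by omega) with c | c <;>
          simp [c, h0, h1]
  unfold milnorQuad
  simp only [inner]
  rw [← Finset.sum_add_distrib, Finset.sum_range_succ, Finset.sum_range_succ, h0, h1,
    Fin.sum_univ_eq_sum_range (fun i => f i + (f i * f (i + 1) + f i * f (i + 2)))]
  simp only [zero_mul, add_zero]
  exact Finset.sum_congr rfl fun i _ => by ring

theorem auxF_per (a b : ZMod 2) (M i : ℕ) : auxF a b (6 * M + i) = auxF a b i := by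
  unfold auxF
  rw [show (6 * M + i) % 3 = i % 3 by omega, show (6 * M + i) % 6 = i % 6 by omega]

theorem block (a b : ZMod 2) (M : ℕ) : ∑ i ∈ Finset.range (6 * M),
    auxF a b i * (1 + auxF a b (i + 1) + auxF a b (i + 2)) = 0 := by
  induction M with
  | zero => simp
  | succ M ih =>
    rw [show 6 * (M + 1) = 6 * M + 6 by ring, Finset.sum_range_add, ih, zero_add]
    simp only [add_assoc, auxF_per]
    clear ih
    revert a b
    unfold auxF
    decide

/-- Let `M ≥ 1` and `g = 3M - 2`.  The quadratic form
`q(v) = Σᵢ vᵢ + Σ_{i<j, j-i≤2} vᵢ vⱼ` on `V = (ℤ/2ℤ)^(2g+2)` vanishes on the span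
of the radical generators `r₁ = Σ_{k<2M} e_{3k+1}` and
`r₂ = Σ_{k<M} (e_{6k+1} + e_{6k+2} + e_{6k+3})`. -/
theorem quadratic_form_vanishes_on_radical (M : ℕ) (hM : 1 ≤ M) (g : ℕ)
    (hg : g = 3 * M - 2) :
    ∀ v ∈ Submodule.span (ZMod 2) {radGen₁ M g, radGen₂ M g}, milnorQuad g v = 0 := by
  rintro v hv
  obtain ⟨a, b, rfl⟩ := Submodule.mem_span_pair.1 hv
  have h6 : 2 * g + 4 = 6 * M := by omega
  have e : a • radGen₁ M g + b • radGen₂ M g = fun i : Fin (2 * g + 2) => auxF a b (i : ℕ) := by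
    funext i
    simp only [Pi.add_apply, Pi.smul_apply, smul_eq_mul, rad1_eq M g h6, rad2_eq M g h6, auxF]
  rw [e, quad_eq, h6, block]
  · unfold auxF
    rw [if_neg (by omega), if_neg (by omega)]; simp
  · unfold auxF
    rw [if_neg (by omega), if_neg (by omega)]; simp
end

section
/- Let M ≥ 1 be an integer and g = 3M − 2. Let V = (ℤ/2ℤ)^{2g+2} with standard basis e₁, …, e_{2g+2} and let q : V → ℤ/2ℤ be the quadratic form q(v) = Σ_{i=1}^{2g+2} vᵢ + Σ_{1 ≤ i < j ≤ 2g+2, j−i ≤ 2} vᵢvⱼ. Then q takes the value 1 on the two vectors u₁ = Σ_{k=0}^{2M−2} e_{3k+1} = e₁ + e₄ + ⋯ + e_{2g−1} and u₂ = Σ_{k=0}^{M−2}(e_{6k+1} + e_{6k+2} + e_{6k+3}) + e_{2g−1} + e_{2g} = e₁ + e₂ + e₃ + e₇ + e₈ + e₉ + ⋯ + e_{2g−1} + e_{2g}, i.e. q(u₁) = 1 and q(u₂) = 1. -/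
open Finset

/-- `u₁ = Σ_{k=0}^{2M-2} e_{3k+1} = e₁ + e₄ + ⋯ + e_{2g-1}` (1-based basis vectors,
so `e_{3k+1}` is the indicator of the 0-based coordinate `3k`). -/
def uVec₁ (M g : ℕ) : Fin (2 * g + 2) → ZMod 2 :=
  ∑ k ∈ Finset.range (2 * M - 1), fun i => if (i : ℕ) = 3 * k then 1 else 0

/-- `u₂ = Σ_{k=0}^{M-2} (e_{6k+1} + e_{6k+2} + e_{6k+3}) + e_{2g-1} + e_{2g}`
(1-based basis vectors; `e_{2g-1}` and `e_{2g}` are the indicators of the 0-based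
coordinates `2g-2` and `2g-1`). -/
def uVec₂ (M g : ℕ) : Fin (2 * g + 2) → ZMod 2 :=
  (∑ k ∈ Finset.range (M - 1), fun i : Fin (2 * g + 2) =>
      if (i : ℕ) = 6 * k ∨ (i : ℕ) = 6 * k + 1 ∨ (i : ℕ) = 6 * k + 2 then
        (1 : ZMod 2) else 0) +
    (fun i : Fin (2 * g + 2) => if (i : ℕ) = 2 * g - 2 then (1 : ZMod 2) else 0) +
    (fun i : Fin (2 * g + 2) => if (i : ℕ) = 2 * g - 1 then (1 : ZMod 2) else 0)

lemma milnorQuad_eq_range (g : ℕ) (v : Fin (2 * g + 2) → ZMod 2) (f : ℕ → ZMod 2)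
    (hv : ∀ i : Fin (2 * g + 2), v i = f i) (hf : ∀ n, 2 * g + 2 ≤ n → f n = 0) :
    milnorQuad g v = ∑ i ∈ range (2 * g + 2), (f i + f i * (f (i + 1) + f (i + 2))) := by
  unfold milnorQuad
  rw [Finset.sum_add_distrib]
  congr 1
  · rw [← Fin.sum_univ_eq_sum_range f]
    exact Finset.sum_congr rfl fun i _ => hv i
  · rw [← Fin.sum_univ_eq_sum_range (fun i => f i * (f (i + 1) + f (i + 2)))]
    refine Finset.sum_congr rfl fun i _ => ?_
    have h1 : ∀ j : Fin (2 * g + 2),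
        (if i < j ∧ j.val - i.val ≤ 2 then v i * v j else 0) =
        (fun n : ℕ => (if n = i.val + 1 then f i * f n else 0) +
          (if n = i.val + 2 then f i * f n else 0)) j.val := by
      intro j
      simp only [hv, Fin.lt_def]
      by_cases a : j.val = i.val + 1
      · simp [a]
      · by_cases b : j.val = i.val + 2
        · simp [b]
        · rw [if_neg a, if_neg b, if_neg (by omega)]; simp
    rw [Finset.sum_congr rfl fun j _ => h1 j,
      Fin.sum_univ_eq_sum_range (fun n : ℕ => (if n = i.val + 1 then f i * f n else 0) +
          (if n = i.val + 2 then f i * f n else 0)), Finset.sum_add_distrib,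
      Finset.sum_ite_eq', Finset.sum_ite_eq', mul_add]
    congr 1
    · split_ifs with h
      · rfl
      · rw [hf (i.val + 1) (by simp only [Finset.mem_range] at h; omega), mul_zero]
    · split_ifs with h
      · rfl
      · rw [hf (i.val + 2) (by simp only [Finset.mem_range] at h; omega), mul_zero]

lemma sum_blocks (t : ℕ → ZMod 2) (m : ℕ)
    (h : ∀ k < m, t (6*k) + t (6*k+1) + t (6*k+2) + t (6*k+3) + t (6*k+4) + t (6*k+5) = 0) :
    ∑ i ∈ range (6 * m), t i = 0 := by
  induction m with
  | zero => simp
  | succ n ih =>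
    rw [show 6 * (n + 1) = 6 * n + 1 + 1 + 1 + 1 + 1 + 1 by ring]
    simp only [Finset.sum_range_succ]
    rw [ih fun k hk => h k (by omega)]
    simpa using h n (by omega)

lemma uVec₁_apply (m g : ℕ) (i : Fin (2 * g + 2)) :
    uVec₁ (m + 1) g i = if (i : ℕ) % 3 = 0 ∧ (i : ℕ) ≤ 6 * m then 1 else 0 := by
  unfold uVec₁
  rw [Finset.sum_apply]
  split_ifs with h
  · rw [Finset.sum_eq_single ((i : ℕ) / 3)]
    · rw [if_pos (by omega)]
    · intro b _ hb
      rw [if_neg (by omega)]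
    · intro hb
      simp only [Finset.mem_range] at hb
      omega
  · refine Finset.sum_eq_zero fun k hk => ?_
    simp only [Finset.mem_range] at hk
    rw [if_neg (by omega)]

lemma uVec₂_apply (m g : ℕ) (hg : g = 3 * m + 1) (i : Fin (2 * g + 2)) :
    uVec₂ (m + 1) g i = if (i : ℕ) % 6 < 3 ∧ (i : ℕ) ≤ 6 * m + 1 then 1 else 0 := by
  unfold uVec₂
  simp only [Pi.add_apply, Finset.sum_apply]
  by_cases h : (i : ℕ) % 6 < 3 ∧ (i : ℕ) < 6 * m
  · rw [Finset.sum_eq_single ((i : ℕ) / 6)]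
    · rw [if_pos (by omega), if_neg (by omega), if_neg (by omega), if_pos (by omega)]; simp
    · intro b _ hb
      rw [if_neg (by omega)]
    · intro hb
      simp only [Finset.mem_range] at hb
      omega
  · rw [Finset.sum_eq_zero]
    · by_cases a : (i : ℕ) = 6 * m
      · rw [if_pos (by omega), if_neg (by omega), if_pos (by omega)]; simp
      · by_cases b : (i : ℕ) = 6 * m + 1
        · rw [if_neg (by omega), if_pos (by omega), if_pos (by omega)]; simp
        · rw [if_neg (by omega), if_neg (by omega), if_neg (by omega)]; simp
    · intro k hk
      simp only [Finset.mem_range] at hk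
      rw [if_neg (by omega)]

theorem quadratic_form_on_expressed_cycles (M : ℕ) (hM : 1 ≤ M) (g : ℕ)
    (hg : g = 3 * M - 2) :
    milnorQuad g (uVec₁ M g) = 1 ∧ milnorQuad g (uVec₂ M g) = 1 := by
  obtain ⟨m, rfl⟩ : ∃ m, M = m + 1 := ⟨M - 1, by omega⟩
  have hg' : g = 3 * m + 1 := by omega
  have hN : 2 * g + 2 = 6 * m + 1 + 1 + 1 + 1 := by omega
  constructor
  · set f : ℕ → ZMod 2 := fun n => if n % 3 = 0 ∧ n ≤ 6 * m then 1 else 0 with hfd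
    have f1 : ∀ n, n % 3 = 0 ∧ n ≤ 6 * m → f n = 1 := fun n h => if_pos h
    have f0 : ∀ n, ¬ (n % 3 = 0 ∧ n ≤ 6 * m) → f n = 0 := fun n h => if_neg h
    rw [milnorQuad_eq_range g _ f (uVec₁_apply m g) fun n hn => f0 n (by omega), hN]
    simp only [Finset.sum_range_succ]
    rw [sum_blocks]
    · rw [f1 (6*m) (by omega), f0 (6*m+1) (by omega), f0 (6*m+2) (by omega),
        f0 (6*m+3) (by omega)]
      simp
    · intro k hk
      rw [f1 (6*k) (by omega), f0 (6*k+1) (by omega), f0 (6*k+2) (by omega),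
        f1 (6*k+3) (by omega), f0 (6*k+4) (by omega), f0 (6*k+5) (by omega)]
      simp only [zero_mul, add_zero, mul_zero]
      decide
  · set f : ℕ → ZMod 2 := fun n => if n % 6 < 3 ∧ n ≤ 6 * m + 1 then 1 else 0 with hfd
    have f1 : ∀ n, n % 6 < 3 ∧ n ≤ 6 * m + 1 → f n = 1 := fun n h => if_pos h
    have f0 : ∀ n, ¬ (n % 6 < 3 ∧ n ≤ 6 * m + 1) → f n = 0 := fun n h => if_neg h
    rw [milnorQuad_eq_range g _ f (uVec₂_apply m g hg') fun n hn => f0 n (by omega), hN]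
    simp only [Finset.sum_range_succ]
    rw [sum_blocks]
    · rw [f1 (6*m) (by omega), f1 (6*m+1) (by omega), f0 (6*m+2) (by omega),
        f0 (6*m+3) (by omega)]
      simp only [zero_mul, add_zero, mul_zero]
      decide
    · intro k hk
      rw [f1 (6*k) (by omega), f1 (6*k+1) (by omega), f1 (6*k+2) (by omega),
        f0 (6*k+3) (by omega), f0 (6*k+4) (by omega), f0 (6*k+5) (by omega)]
      simp only [zero_mul, add_zero, mul_zero]
      decide
end

section
/- Let g ≥ 1 and let E be the set of unordered pairs on {1, …, 2g+2} consisting of: {i, i+1} for 1 ≤ i ≤ g; {g+1+i, g+2+i} for 1 ≤ i ≤ g; {i, g+1+i} for 1 ≤ i ≤ g+1; and {i, g+2+i} for 1 ≤ i ≤ g. Let G be any group and T₁, …, T_{2g+2} ∈ G elements satisfying TᵢTⱼ = TⱼTᵢ whenever {i,j} ∉ E. Then T_{2g+2}·T_{2g+1}·⋯·T₂·T₁ = (T_{2g+2}T_{g+1})·(T_{2g+1}T_g)·⋯·(T_{g+3}T₂)·(T_{g+2}T₁), i.e. the descending product of all generators equals the product of the pairs T_{g+1+k}T_k for k = g+1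 down to 1. -/
/-- The edge relation of the intersection graph of vanishing cycles for the
discriminant in the trigonal linear system: the unordered pairs on `{1, …, 2g+2}`
of the form `{a, a+1}` for `1 ≤ a ≤ g`, `{g+1+a, g+2+a}` for `1 ≤ a ≤ g`,
`{a, g+1+a}` for `1 ≤ a ≤ g+1`, and `{a, g+2+a}` for `1 ≤ a ≤ g`. -/
def TrigEdge (g i j : ℕ) : Prop :=
  (∃ a, 1 ≤ a ∧ a ≤ g ∧ ((i = a ∧ j = a + 1) ∨ (j = a ∧ i = a + 1))) ∨
  (∃ a, 1 ≤ a ∧ a ≤ g ∧ ((i = g + 1 + a ∧ j = g + 2 + a) ∨ (j = g + 1 + a ∧ i = g + 2 + a))) ∨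
  (∃ a, 1 ≤ a ∧ a ≤ g + 1 ∧ ((i = a ∧ j = g + 1 + a) ∨ (j = a ∧ i = g + 1 + a))) ∨
  (∃ a, 1 ≤ a ∧ a ≤ g ∧ ((i = a ∧ j = g + 2 + a) ∨ (j = a ∧ i = g + 2 + a)))

theorem trig_interleave {G : Type*} [Group G] (a b : ℕ → G) (n : ℕ)
    (h : ∀ i j, i < j → j < n → Commute (a j) (b i)) :
    ((List.range n).map a).prod * ((List.range n).map b).prod =
      ((List.range n).map (fun k => a k * b k)).prod := by
  induction n with
  | zero => simp
  | succ n ih =>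
    have ih' := ih (fun i j hij hj => h i j hij (by omega))
    have hc : Commute (a n) ((List.range n).map b).prod := by
      apply Commute.list_prod_right
      intro x hx
      obtain ⟨i, hi, rfl⟩ := List.mem_map.1 hx
      exact h i n (List.mem_range.1 hi) (by omega)
    simp only [List.range_succ, List.map_append, List.prod_append, List.map_cons, List.map_nil,
      List.prod_cons, List.prod_nil, mul_one]
    rw [← ih', mul_assoc, ← mul_assoc (a n), hc.eq]
    simp only [mul_assoc]

/-- Let `g ≥ 1` and `E` the edge set above on `{1, …, 2g+2}`.  If `G` is any group and
`T₁, …, T_{2g+2} ∈ G` satisfy `TᵢTⱼ = TⱼTᵢ` whenever `{i,j} ∉ E`, then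
`T_{2g+2}·T_{2g+1}⋯T₂·T₁ = (T_{2g+2}T_{g+1})·(T_{2g+1}T_g)⋯(T_{g+3}T₂)·(T_{g+2}T₁)`. -/
theorem reorder_descending_product (g : ℕ) (hg : 1 ≤ g) (G : Type*) [Group G]
    (T : ℕ → G)
    (hcomm : ∀ i j, 1 ≤ i → i ≤ 2 * g + 2 → 1 ≤ j → j ≤ 2 * g + 2 →
      ¬ TrigEdge g i j → T i * T j = T j * T i) :
    ((List.range (2 * g + 2)).map (fun k => T (2 * g + 2 - k))).prod =
      ((List.range (g + 1)).map (fun k => T (2 * g + 2 - k) * T (g + 1 - k))).prod := by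
  have key := trig_interleave (fun k => T (2 * g + 2 - k)) (fun k => T (g + 1 - k)) (g + 1) (by
    intro i j hij hj
    refine hcomm _ _ (by omega) (by omega) (by omega) (by omega) ?_
    rintro (⟨a, h⟩ | ⟨a, h⟩ | ⟨a, h⟩ | ⟨a, h⟩) <;> omega)
  rw [← key, show 2 * g + 2 = (g + 1) + (g + 1) by ring, List.range_add, List.map_append,
    List.prod_append, List.map_map]
  congr 3
  funext k
  simp only [Function.comp]
  congr 1
  omega
end

section
/- Let M ≥ 1 be an integer and let F be the free group on generators σ₁, …, σ_{6M−2}. Define elements t₁, …, t_{6M−2} ∈ F as follows (all congruences mod 6): if i ≡ 1 then tᵢ = σ_{6M−(i+3)/2}; if i ≡ 2 then tᵢ = σ_{3M−i/2}; if i ≡ 3 then tᵢ = σ_{3M−(i+1)/2}; if i ≡ 4 then tᵢ = t_{i−1}^{-1}·σ_{6M−(i+2)/2}·t_{i−1} (where t_{i−1} = σ_{3M−i/2} by the i ≡ 3 case); if i ≡ 5 then tᵢ = t_{i+1}·σ_{3M−(i+1)/2}·t_{i+1}^{-1} (where t_{i+1} = σ_{6M−(i+3)/2} by the i ≡ 0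 case); if i ≡ 0 then tᵢ = σ_{6M−(i+2)/2}. Then t₁, …, t_{6M−2} is a free generating set of F; equivalently, the endomorphism of F sending the i-th generator to tᵢ is an automorphism of F. -/
/-- The generator `σ_i` (1-based, `1 ≤ i ≤ n`) of the free group on `n` letters. -/
def gen (n i : ℕ) : FreeGroup (Fin n) :=
  if h : 1 ≤ i ∧ i ≤ n then FreeGroup.of ⟨i - 1, by omega⟩ else 1

/-- The element `tᵢ` (1-based, `1 ≤ i ≤ 6M-2`) of the free group `F` on
`σ₁, …, σ_{6M-2}`, defined by cases on `i mod 6`: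
`i ≡ 1`: `tᵢ = σ_{6M-(i+3)/2}`; `i ≡ 2`: `tᵢ = σ_{3M-i/2}`;
`i ≡ 3`: `tᵢ = σ_{3M-(i+1)/2}`;
`i ≡ 4`: `tᵢ = t_{i-1}⁻¹ σ_{6M-(i+2)/2} t_{i-1}` with `t_{i-1} = σ_{3M-i/2}`;
`i ≡ 5`: `tᵢ = t_{i+1} σ_{3M-(i+1)/2} t_{i+1}⁻¹` with `t_{i+1} = σ_{6M-(i+3)/2}`;
`i ≡ 0`: `tᵢ = σ_{6M-(i+2)/2}`. -/
def tGen (M i : ℕ) : FreeGroup (Fin (6 * M - 2)) :=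
  if i % 6 = 1 then gen (6 * M - 2) (6 * M - (i + 3) / 2)
  else if i % 6 = 2 then gen (6 * M - 2) (3 * M - i / 2)
  else if i % 6 = 3 then gen (6 * M - 2) (3 * M - (i + 1) / 2)
  else if i % 6 = 4 then
    (gen (6 * M - 2) (3 * M - i / 2))⁻¹ * gen (6 * M - 2) (6 * M - (i + 2) / 2) *
      gen (6 * M - 2) (3 * M - i / 2)
  else if i % 6 = 5 then
    gen (6 * M - 2) (6 * M - (i + 3) / 2) * gen (6 * M - 2) (3 * M - (i + 1) / 2) *
      (gen (6 * M - 2) (6 * M - (i + 3) / 2))⁻¹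
  else gen (6 * M - 2) (6 * M - (i + 2) / 2)

/-- The inverse substitution. -/
def sGen (M j : ℕ) : FreeGroup (Fin (6 * M - 2)) :=
  if 3 * M ≤ j then
    if (6 * M - 2 - j) % 3 = 0 then gen (6 * M - 2) (2 * (6 * M - 2 - j) + 1)
    else if (6 * M - 2 - j) % 3 = 1 then
      gen (6 * M - 2) (2 * (6 * M - 2 - j) + 1) * gen (6 * M - 2) (2 * (6 * M - 2 - j) + 2) *
        (gen (6 * M - 2) (2 * (6 * M - 2 - j) + 1))⁻¹
    else gen (6 * M - 2) (2 * (6 * M - 2 - j) + 2)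
  else
    if (3 * M - 1 - j) % 3 = 0 then gen (6 * M - 2) (2 * (3 * M - 1 - j) + 2)
    else if (3 * M - 1 - j) % 3 = 1 then gen (6 * M - 2) (2 * (3 * M - 1 - j) + 1)
    else
      (gen (6 * M - 2) (2 * (3 * M - 1 - j) + 2))⁻¹ * gen (6 * M - 2) (2 * (3 * M - 1 - j) + 1) *
        gen (6 * M - 2) (2 * (3 * M - 1 - j) + 2)

def phi (M : ℕ) : FreeGroup (Fin (6 * M - 2)) →* FreeGroup (Fin (6 * M - 2)) :=
  FreeGroup.lift (fun i : Fin (6 * M - 2) => tGen M ((i : ℕ) + 1))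

def psi (M : ℕ) : FreeGroup (Fin (6 * M - 2)) →* FreeGroup (Fin (6 * M - 2)) :=
  FreeGroup.lift (fun i : Fin (6 * M - 2) => sGen M ((i : ℕ) + 1))

lemma gen_succ (n : ℕ) (a : Fin n) : gen n (a.1 + 1) = FreeGroup.of a := by
  have := a.2
  unfold gen
  rw [dif_pos (by omega)]
  rfl

lemma phi_gen (M i : ℕ) (h1 : 1 ≤ i) (h2 : i ≤ 6 * M - 2) :
    phi M (gen (6 * M - 2) i) = tGen M i := by
  unfold phi gen
  rw [dif_pos ⟨h1, h2⟩, FreeGroup.lift_apply_of]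
  congr 1
  simp only
  omega

lemma psi_gen (M i : ℕ) (h1 : 1 ≤ i) (h2 : i ≤ 6 * M - 2) :
    psi M (gen (6 * M - 2) i) = sGen M i := by
  unfold psi gen
  rw [dif_pos ⟨h1, h2⟩, FreeGroup.lift_apply_of]
  congr 1
  simp only
  omega

lemma tGen_1 (M q : ℕ) (h : 6 * q + 1 ≤ 6 * M - 2) :
    tGen M (6 * q + 1) = gen (6 * M - 2) (6 * M - 2 - (3 * q + 0)) := by
  unfold tGen
  rw [if_pos (by omega)]
  have e0 : 6 * M - ((6 * q + 1) + 3) / 2 = (6 * M - 2 - (3 * q + 0)) := by omega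
  rw [e0]

lemma sGen_1 (M q : ℕ) (h : 6 * q + 1 ≤ 6 * M - 2) :
    sGen M (6 * M - 2 - (3 * q + 0)) = gen (6 * M - 2) (6 * q + 1) := by
  unfold sGen
  rw [if_pos (by omega)]
  rw [if_pos (by omega)]
  have e0 : 2 * (6 * M - 2 - (6 * M - 2 - (3 * q + 0))) + 1 = 6 * q + 1 := by omega
  rw [e0]

lemma tGen_4 (M q : ℕ) (h : 6 * q + 4 ≤ 6 * M - 2) :
    tGen M (6 * q + 4) = (gen (6 * M - 2) (3 * M - 1 - (3 * q + 1)))⁻¹ * gen (6 * M - 2) (6 * M - 2 - (3 * q + 1)) * gen (6 * M - 2) (3 * M - 1 - (3 * q + 1)) := by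
  unfold tGen
  rw [if_neg (by omega)]
  rw [if_neg (by omega)]
  rw [if_neg (by omega)]
  rw [if_pos (by omega)]
  have e0 : 3 * M - (6 * q + 4) / 2 = (3 * M - 1 - (3 * q + 1)) := by omega
  have e1 : 6 * M - ((6 * q + 4) + 2) / 2 = (6 * M - 2 - (3 * q + 1)) := by omega
  rw [e0, e1]

lemma sGen_4 (M q : ℕ) (h : 6 * q + 4 ≤ 6 * M - 2) :
    sGen M (6 * M - 2 - (3 * q + 1)) = gen (6 * M - 2) (6 * q + 3) * gen (6 * M - 2) (6 * q + 4) * (gen (6 * M - 2) (6 * q + 3))⁻¹ := by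
  unfold sGen
  rw [if_pos (by omega)]
  rw [if_neg (by omega)]
  rw [if_pos (by omega)]
  have e0 : 2 * (6 * M - 2 - (6 * M - 2 - (3 * q + 1))) + 1 = 6 * q + 3 := by omega
  have e1 : 2 * (6 * M - 2 - (6 * M - 2 - (3 * q + 1))) + 2 = 6 * q + 4 := by omega
  rw [e0, e1]

lemma tGen_6 (M q : ℕ) (h : 6 * q + 6 ≤ 6 * M - 2) :
    tGen M (6 * q + 6) = gen (6 * M - 2) (6 * M - 2 - (3 * q + 2)) := by
  unfold tGen
  rw [if_neg (by omega)]
  rw [if_neg (by omega)]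
  rw [if_neg (by omega)]
  rw [if_neg (by omega)]
  rw [if_neg (by omega)]
  have e0 : 6 * M - ((6 * q + 6) + 2) / 2 = (6 * M - 2 - (3 * q + 2)) := by omega
  rw [e0]

lemma sGen_6 (M q : ℕ) (h : 6 * q + 6 ≤ 6 * M - 2) :
    sGen M (6 * M - 2 - (3 * q + 2)) = gen (6 * M - 2) (6 * q + 6) := by
  unfold sGen
  rw [if_pos (by omega)]
  rw [if_neg (by omega)]
  rw [if_neg (by omega)]
  have e0 : 2 * (6 * M - 2 - (6 * M - 2 - (3 * q + 2))) + 2 = 6 * q + 6 := by omega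
  rw [e0]

lemma tGen_2 (M q : ℕ) (h : 6 * q + 2 ≤ 6 * M - 2) :
    tGen M (6 * q + 2) = gen (6 * M - 2) (3 * M - 1 - (3 * q + 0)) := by
  unfold tGen
  rw [if_neg (by omega)]
  rw [if_pos (by omega)]
  have e0 : 3 * M - (6 * q + 2) / 2 = (3 * M - 1 - (3 * q + 0)) := by omega
  rw [e0]

lemma sGen_2 (M q : ℕ) (h : 6 * q + 2 ≤ 6 * M - 2) :
    sGen M (3 * M - 1 - (3 * q + 0)) = gen (6 * M - 2) (6 * q + 2) := by
  unfold sGen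
  rw [if_neg (by omega)]
  rw [if_pos (by omega)]
  have e0 : 2 * (3 * M - 1 - (3 * M - 1 - (3 * q + 0))) + 2 = 6 * q + 2 := by omega
  rw [e0]

lemma tGen_3 (M q : ℕ) (h : 6 * q + 3 ≤ 6 * M - 2) :
    tGen M (6 * q + 3) = gen (6 * M - 2) (3 * M - 1 - (3 * q + 1)) := by
  unfold tGen
  rw [if_neg (by omega)]
  rw [if_neg (by omega)]
  rw [if_pos (by omega)]
  have e0 : 3 * M - ((6 * q + 3) + 1) / 2 = (3 * M - 1 - (3 * q + 1)) := by omega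
  rw [e0]

lemma sGen_3 (M q : ℕ) (h : 6 * q + 3 ≤ 6 * M - 2) :
    sGen M (3 * M - 1 - (3 * q + 1)) = gen (6 * M - 2) (6 * q + 3) := by
  unfold sGen
  rw [if_neg (by omega)]
  rw [if_neg (by omega)]
  rw [if_pos (by omega)]
  have e0 : 2 * (3 * M - 1 - (3 * M - 1 - (3 * q + 1))) + 1 = 6 * q + 3 := by omega
  rw [e0]

lemma tGen_5 (M q : ℕ) (h : 6 * q + 5 ≤ 6 * M - 2) :
    tGen M (6 * q + 5) = gen (6 * M - 2) (6 * M - 2 - (3 * q + 2)) * gen (6 * M - 2) (3 * M - 1 - (3 * q + 2)) * (gen (6 * M - 2) (6 * M - 2 - (3 * q + 2)))⁻¹ := by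
  unfold tGen
  rw [if_neg (by omega)]
  rw [if_neg (by omega)]
  rw [if_neg (by omega)]
  rw [if_neg (by omega)]
  rw [if_pos (by omega)]
  have e0 : 6 * M - ((6 * q + 5) + 3) / 2 = (6 * M - 2 - (3 * q + 2)) := by omega
  have e1 : 3 * M - ((6 * q + 5) + 1) / 2 = (3 * M - 1 - (3 * q + 2)) := by omega
  rw [e0, e1]

lemma sGen_5 (M q : ℕ) (h : 6 * q + 5 ≤ 6 * M - 2) :
    sGen M (3 * M - 1 - (3 * q + 2)) = (gen (6 * M - 2) (6 * q + 6))⁻¹ * gen (6 * M - 2) (6 * q + 5) * gen (6 * M - 2) (6 * q + 6) := by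
  unfold sGen
  rw [if_neg (by omega)]
  rw [if_neg (by omega)]
  rw [if_neg (by omega)]
  have e0 : 2 * (3 * M - 1 - (3 * M - 1 - (3 * q + 2))) + 2 = 6 * q + 6 := by omega
  have e1 : 2 * (3 * M - 1 - (3 * M - 1 - (3 * q + 2))) + 1 = 6 * q + 5 := by omega
  rw [e0, e1]

lemma psi_tGen (M i : ℕ) (h1 : 1 ≤ i) (h2 : i ≤ 6 * M - 2) :
    psi M (tGen M i) = gen (6 * M - 2) i := by
  obtain ⟨q, hq⟩ : ∃ q, i = 6 * q + 1 ∨ i = 6 * q + 2 ∨ i = 6 * q + 3 ∨ i = 6 * q + 4 ∨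
      i = 6 * q + 5 ∨ i = 6 * q + 6 := ⟨(i - 1) / 6, by omega⟩
  rcases hq with rfl | rfl | rfl | rfl | rfl | rfl
  · rw [tGen_1 M q h2, psi_gen M (6 * M - 2 - (3 * q + 0)) (by omega) (by omega), sGen_1 M q h2]
  · rw [tGen_2 M q h2, psi_gen M (3 * M - 1 - (3 * q + 0)) (by omega) (by omega), sGen_2 M q h2]
  · rw [tGen_3 M q h2, psi_gen M (3 * M - 1 - (3 * q + 1)) (by omega) (by omega), sGen_3 M q h2]
  · rw [tGen_4 M q h2]
    simp only [map_mul, map_inv]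
    rw [psi_gen M (3 * M - 1 - (3 * q + 1)) (by omega) (by omega), psi_gen M (6 * M - 2 - (3 * q + 1)) (by omega) (by omega), sGen_4 M q h2,
      sGen_3 M q (by omega)]
    group
  · rw [tGen_5 M q h2]
    simp only [map_mul, map_inv]
    rw [psi_gen M (6 * M - 2 - (3 * q + 2)) (by omega) (by omega), psi_gen M (3 * M - 1 - (3 * q + 2)) (by omega) (by omega), sGen_5 M q h2,
      sGen_6 M q (by omega)]
    group
  · rw [tGen_6 M q h2, psi_gen M (6 * M - 2 - (3 * q + 2)) (by omega) (by omega), sGen_6 M q h2]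

lemma phi_sGen (M j : ℕ) (h1 : 1 ≤ j) (h2 : j ≤ 6 * M - 2) :
    phi M (sGen M j) = gen (6 * M - 2) j := by
  obtain ⟨q, hq⟩ : ∃ q, (6 * q + 1 ≤ 6 * M - 2 ∧ j = (6 * M - 2 - (3 * q + 0))) ∨
      (6 * q + 2 ≤ 6 * M - 2 ∧ j = (3 * M - 1 - (3 * q + 0))) ∨
      (6 * q + 3 ≤ 6 * M - 2 ∧ j = (3 * M - 1 - (3 * q + 1))) ∨
      (6 * q + 4 ≤ 6 * M - 2 ∧ j = (6 * M - 2 - (3 * q + 1))) ∨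
      (6 * q + 5 ≤ 6 * M - 2 ∧ j = (3 * M - 1 - (3 * q + 2))) ∨
      (6 * q + 6 ≤ 6 * M - 2 ∧ j = (6 * M - 2 - (3 * q + 2))) := by
    by_cases h : 3 * M ≤ j
    · exact ⟨(6 * M - 2 - j) / 3, by omega⟩
    · exact ⟨(3 * M - 1 - j) / 3, by omega⟩
  rcases hq with ⟨h, rfl⟩ | ⟨h, rfl⟩ | ⟨h, rfl⟩ | ⟨h, rfl⟩ | ⟨h, rfl⟩ | ⟨h, rfl⟩
  · rw [sGen_1 M q h, phi_gen M (6 * q + 1) (by omega) (by omega), tGen_1 M q h]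
  · rw [sGen_2 M q h, phi_gen M (6 * q + 2) (by omega) (by omega), tGen_2 M q h]
  · rw [sGen_3 M q h, phi_gen M (6 * q + 3) (by omega) (by omega), tGen_3 M q h]
  · rw [sGen_4 M q h]
    simp only [map_mul, map_inv]
    rw [phi_gen M (6 * q + 3) (by omega) (by omega), phi_gen M (6 * q + 4) (by omega) (by omega), tGen_4 M q h,
      tGen_3 M q (by omega)]
    group
  · rw [sGen_5 M q h]
    simp only [map_mul, map_inv]
    rw [phi_gen M (6 * q + 6) (by omega) (by omega), phi_gen M (6 * q + 5) (by omega) (by omega), tGen_5 M q h,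
      tGen_6 M q (by omega)]
    group
  · rw [sGen_6 M q h, phi_gen M (6 * q + 6) (by omega) (by omega), tGen_6 M q h]

/-- Let `M ≥ 1` and `F` the free group on `σ₁, …, σ_{6M-2}`.  The elements
`t₁, …, t_{6M-2}` defined above form a free generating set of `F`; equivalently,
the endomorphism of `F` sending the `i`-th generator to `tᵢ` is an automorphism. -/
theorem t_generators_free_basis (M : ℕ) (hM : 1 ≤ M) :
    Function.Bijective
      (FreeGroup.lift (fun i : Fin (6 * M - 2) => tGen M ((i : ℕ) + 1)) :
        FreeGroup (Fin (6 * M - 2)) →* FreeGroup (Fin (6 * M - 2))) := by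
  rw [Function.bijective_iff_has_inverse]
  refine ⟨psi M, fun x => ?_, fun x => ?_⟩
  · have h : (psi M).comp (phi M) = MonoidHom.id _ := by
      apply FreeGroup.ext_hom
      intro a
      have ha := a.2
      have e : FreeGroup.of a = gen (6 * M - 2) (a.1 + 1) := (gen_succ _ a).symm
      simp only [MonoidHom.comp_apply, MonoidHom.id_apply]
      rw [e, phi_gen M _ (by omega) (by omega)]
      exact psi_tGen M _ (by omega) (by omega)
    exact DFunLike.congr_fun h x
  · have h : (phi M).comp (psi M) = MonoidHom.id _ := by
      apply FreeGroup.ext_hom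
      intro a
      have ha := a.2
      have e : FreeGroup.of a = gen (6 * M - 2) (a.1 + 1) := (gen_succ _ a).symm
      simp only [MonoidHom.comp_apply, MonoidHom.id_apply]
      rw [e, psi_gen M _ (by omega) (by omega)]
      exact phi_sGen M _ (by omega) (by omega)
    exact DFunLike.congr_fun h x
end
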